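/- arXiv:2211.12429 — 12 statements merged into one kernel-verified Lean document; each statement's English description precedes it below -/
import Mathlib

section
/- Let k > 0 and let r : ℝ → ℝ satisfy r(s) ≥ -k² for all s ∈ ℝ. If u : ℝ → ℝ is differentiable and satisfies the Riccati equation u'(s) + u(s)² + r(s) = 0 for every s ∈ ℝ, then |u(s)| ≤ k for all s ∈ ℝ. -/
theorem riccati_aux (k : ℝ) (hk : 0 < k) (v v' : ℝ → ℝ)
    (hv : ∀ s, HasDerivAt v (v' s) s) (h : ∀ s, v s ^ 2 - k ^ 2 ≤ v' s) :
    ∀ s, v s ≤ k := by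
  intro a
  by_contra hcon
  have ha : 0 < v a - k := by linarith [not_le.mp hcon]
  have hd : ∀ s, HasDerivAt (fun s => (v s - k) * Real.exp (-(2 * k) * s))
      (v' s * Real.exp (-(2 * k) * s)
        + (v s - k) * (Real.exp (-(2 * k) * s) * (-(2 * k) * 1))) s := fun s =>
    ((hv s).sub_const k).mul (((hasDerivAt_id s).const_mul (-(2 * k))).exp)
  have hm : Monotone (fun s => (v s - k) * Real.exp (-(2 * k) * s)) := by
    apply monotone_of_deriv_nonneg (fun s => (hd s).differentiableAt)
    intro s
    rw [(hd s).deriv]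
    have h1 : 0 ≤ v' s - 2 * k * (v s - k) := by nlinarith [h s, sq_nonneg (v s - k)]
    nlinarith [mul_nonneg h1 (Real.exp_pos (-(2 * k) * s)).le]
  have hpos : ∀ s, a ≤ s → 0 < v s - k := by
    intro s hs
    have h1 : (v a - k) * Real.exp (-(2 * k) * a) ≤ (v s - k) * Real.exp (-(2 * k) * s) := hm hs
    have h2 : 0 < (v s - k) * Real.exp (-(2 * k) * s) :=
      lt_of_lt_of_le (mul_pos ha (Real.exp_pos _)) h1
    exact pos_of_mul_pos_left h2 (Real.exp_pos _).le
  have hd2 : ∀ s, a ≤ s → HasDerivAt (fun s => (v s - k)⁻¹ + s)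
      (-v' s / (v s - k) ^ 2 + 1) s := fun s hs =>
    (((hv s).sub_const k).inv (hpos s hs).ne').add (hasDerivAt_id s)
  have hanti : AntitoneOn (fun s => (v s - k)⁻¹ + s) (Set.Ici a) := by
    apply antitoneOn_of_deriv_nonpos (convex_Ici a)
    · exact fun s hs => (hd2 s hs).continuousAt.continuousWithinAt
    · intro s hs
      exact (hd2 s (interior_subset hs)).differentiableAt.differentiableWithinAt
    · intro s hs
      have hs' : a ≤ s := interior_subset hs
      rw [(hd2 s hs').deriv]
      have hp := hpos s hs'
      have : -v' s / (v s - k) ^ 2 ≤ -1 := by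
        rw [div_le_iff₀ (by positivity)]
        nlinarith [h s]
      linarith
  have hb : a ≤ a + (v a - k)⁻¹ := by
    have := inv_pos.mpr ha
    linarith
  have h3 : (v (a + (v a - k)⁻¹) - k)⁻¹ + (a + (v a - k)⁻¹) ≤ (v a - k)⁻¹ + a :=
    hanti (Set.self_mem_Ici) hb hb
  have h4 := inv_pos.mpr (hpos _ hb)
  linarith


/-- Let `k > 0` and `r : ℝ → ℝ` satisfy `r s ≥ -k²` for all `s`.
If `u : ℝ → ℝ` is differentiable and satisfies the Riccati equation
`u' s + (u s)² + r s = 0` for every `s`, then `|u s| ≤ k` for all `s`. -/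
theorem riccati_bounded (k : ℝ) (hk : 0 < k) (r u : ℝ → ℝ)
    (hr : ∀ s : ℝ, r s ≥ -k ^ 2)
    (hu : Differentiable ℝ u)
    (hric : ∀ s : ℝ, deriv u s + (u s) ^ 2 + r s = 0) :
    ∀ s : ℝ, |u s| ≤ k := by
  intro s
  have h0 : ∀ s, u s ^ 2 - k ^ 2 ≤ -deriv u s := fun s => by linarith [hr s, hric s]
  rw [abs_le]
  constructor
  · have := riccati_aux k hk (fun s => -u s) (fun s => -deriv u s)
      (fun s => (hu s).hasDerivAt.neg) (fun s => by simpa using h0 s) s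
    linarith
  · have := riccati_aux k hk (fun s => u (-s)) (fun s => -deriv u (-s))
      (fun s => by
        have := (hu (-s)).hasDerivAt.comp s (hasDerivAt_neg s)
        simpa [Function.comp_def] using this) (fun s => h0 (-s)) (-s)
    simpa using this
end

section
/- Let k > 0 and let r : ℝ → ℝ satisfy r(s) ≥ -k² for all s > 0. If u : (0,∞) → ℝ is differentiable and satisfies the Riccati equation u'(s) + u(s)² + r(s) = 0 for every s > 0, then |u(s)| ≤ k·coth(ks) for all s > 0. -/
/-- The hyperbolic cotangent. -/
noncomputable def coth (x : ℝ) : ℝ := Real.cosh x / Real.sinh x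

lemma riccati_aux_s1 (k : ℝ) (r u u' : ℝ → ℝ)
    (hr : ∀ s : ℝ, 0 < s → r s ≥ -k ^ 2)
    (hu : ∀ s : ℝ, 0 < s → HasDerivAt u (u' s) s)
    (hric : ∀ s : ℝ, 0 < s → u' s + (u s) ^ 2 + r s = 0) (a : ℝ) :
    AntitoneOn (fun t => u t * Real.sinh (k * (t - a)) ^ 2
      - k * Real.cosh (k * (t - a)) * Real.sinh (k * (t - a))) (Set.Ioi 0) := by
  have hd : ∀ t : ℝ, 0 < t → HasDerivAt (fun t => u t * Real.sinh (k * (t - a)) ^ 2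
      - k * Real.cosh (k * (t - a)) * Real.sinh (k * (t - a)))
      (u' t * Real.sinh (k * (t - a)) ^ 2
        + 2 * k * u t * Real.sinh (k * (t - a)) * Real.cosh (k * (t - a))
        - k ^ 2 * (Real.cosh (k * (t - a)) ^ 2 + Real.sinh (k * (t - a)) ^ 2)) t := by
    intro t ht
    have hl : HasDerivAt (fun t : ℝ => k * (t - a)) k t := by
      simpa using ((hasDerivAt_id t).sub_const a).const_mul k
    have h := ((hu t ht).mul (hl.sinh.pow 2)).sub ((hl.cosh.const_mul k).mul hl.sinh)
    refine h.congr_deriv ?_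
    simp
    ring
  refine antitoneOn_of_deriv_nonpos (convex_Ioi 0)
    (fun t ht => (hd t ht).continuousAt.continuousWithinAt) ?_ ?_
  · intro t ht
    rw [interior_Ioi] at ht
    exact (hd t ht).differentiableAt.differentiableWithinAt
  · intro t ht
    rw [interior_Ioi] at ht
    rw [(hd t ht).deriv]
    have h1 : u' t ≤ k ^ 2 - u t ^ 2 := by linarith [hr t ht, hric t ht]
    have h2 := mul_le_mul_of_nonneg_right h1 (sq_nonneg (Real.sinh (k * (t - a))))
    nlinarith [sq_nonneg (u t * Real.sinh (k * (t - a)) - k * Real.cosh (k * (t - a)))]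

/-- Let `k > 0` and let `r : ℝ → ℝ` satisfy `r s ≥ -k²` for all `s > 0`.
If `u` is differentiable on `(0,∞)` (with derivative `u'`) and satisfies the Riccati
equation `u' s + (u s)² + r s = 0` for every `s > 0`, then `|u s| ≤ k·coth (k s)`
for all `s > 0`. -/
theorem riccati_coth_bound (k : ℝ) (hk : 0 < k) (r u u' : ℝ → ℝ)
    (hr : ∀ s : ℝ, 0 < s → r s ≥ -k ^ 2)
    (hu : ∀ s : ℝ, 0 < s → HasDerivAt u (u' s) s)
    (hric : ∀ s : ℝ, 0 < s → u' s + (u s) ^ 2 + r s = 0) :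
    ∀ s : ℝ, 0 < s → |u s| ≤ k * coth (k * s) := by
  intro s hs
  have hS : 0 < Real.sinh (k * s) := Real.sinh_pos_iff.2 (mul_pos hk hs)
  unfold coth
  rw [← mul_div_assoc, le_div_iff₀ hS]
  have hlow : -(k * Real.cosh (k * s)) ≤ u s * Real.sinh (k * s) := by
    have h := riccati_aux_s1 k r u u' hr hu hric (2 * s) (Set.mem_Ioi.2 hs)
      (Set.mem_Ioi.2 (by linarith : 0 < 2 * s)) (by linarith)
    have e : k * (s - 2 * s) = -(k * s) := by ring
    simp only [sub_self, mul_zero, Real.sinh_zero, e, Real.sinh_neg, Real.cosh_neg] at h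
    refine le_of_mul_le_mul_right ?_ hS
    nlinarith
  have hup : u s * Real.sinh (k * s) ≤ k * Real.cosh (k * s) := by
    have key : ∀ a ∈ Set.Ioo 0 s,
        u s * Real.sinh (k * (s - a)) ≤ k * Real.cosh (k * (s - a)) := by
      intro a ha
      have hSa : 0 < Real.sinh (k * (s - a)) :=
        Real.sinh_pos_iff.2 (mul_pos hk (sub_pos.2 ha.2))
      have h := riccati_aux_s1 k r u u' hr hu hric a (Set.mem_Ioi.2 ha.1)
        (Set.mem_Ioi.2 hs) ha.2.le
      simp only [sub_self, mul_zero, Real.sinh_zero] at h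
      refine le_of_mul_le_mul_right ?_ hSa
      nlinarith
    have c1 : Continuous (fun a : ℝ => u s * Real.sinh (k * (s - a))) := by fun_prop
    have c2 : Continuous (fun a : ℝ => k * Real.cosh (k * (s - a))) := by fun_prop
    have t1 := (c1.tendsto 0).mono_left (nhdsWithin_le_nhds (s := Set.Ioi 0))
    have t2 := (c2.tendsto 0).mono_left (nhdsWithin_le_nhds (s := Set.Ioi 0))
    have := le_of_tendsto_of_tendsto t1 t2
      (Filter.eventually_of_mem (Ioo_mem_nhdsGT hs) key)
    simpa using this
  rw [← abs_of_pos hS, ← abs_mul]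
  exact abs_le.2 ⟨hlow, hup⟩
end

section
/- Let k > 0 and let r : ℝ → ℝ satisfy r(s) ≥ -k² for all s > 0. Let u : (0,∞) → ℝ be differentiable and satisfy the Riccati equation u'(s) + u(s)² + r(s) = 0 for every s > 0. Fix s₀ > 0 and d with 0 < d < k·s₀, and suppose u(s₀) < k·coth(k·s₀ − d). Then u(s) < k·coth(k·s − d) for all s ≥ s₀. -/
/-- Let `k > 0`, `r s ≥ -k²` for `s > 0`, and let `u` be differentiable
on `(0,∞)` (with derivative `u'`) satisfying the Riccati equation there. Fix `s₀ > 0`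
and `d` with `0 < d < k·s₀`, and suppose `u s₀ < k·coth (k·s₀ − d)`. Then
`u s < k·coth (k·s − d)` for all `s ≥ s₀`. -/
theorem riccati_coth_comparison (k : ℝ) (hk : 0 < k) (r u u' : ℝ → ℝ)
    (hr : ∀ s : ℝ, 0 < s → r s ≥ -k ^ 2)
    (hu : ∀ s : ℝ, 0 < s → HasDerivAt u (u' s) s)
    (hric : ∀ s : ℝ, 0 < s → u' s + (u s) ^ 2 + r s = 0)
    (s₀ d : ℝ) (hs₀ : 0 < s₀) (hd : 0 < d) (hdk : d < k * s₀)
    (hinit : u s₀ < k * coth (k * s₀ - d)) :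
    ∀ s : ℝ, s₀ ≤ s → u s < k * coth (k * s - d) := by
  have hpos : ∀ t : ℝ, s₀ ≤ t → 0 < k * t - d := by
    intro t ht
    nlinarith
  have hv : ∀ t : ℝ, s₀ ≤ t → HasDerivAt (fun t => k * coth (k * t - d))
      (k ^ 2 - (k * coth (k * t - d)) ^ 2) t := by
    intro t ht
    have hs : Real.sinh (k * t - d) ≠ 0 := (Real.sinh_pos_iff.mpr (hpos t ht)).ne'
    have hl : HasDerivAt (fun t : ℝ => k * t - d) k t := by
      simpa using ((hasDerivAt_id t).const_mul k).sub_const d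
    have h := ((hl.cosh).div hl.sinh hs).const_mul k
    refine h.congr_deriv ?_
    unfold coth
    field_simp
  have hw : ∀ t : ℝ, s₀ ≤ t → HasDerivAt (fun t => k * coth (k * t - d) - u t)
      (k ^ 2 - (k * coth (k * t - d)) ^ 2 - u' t) t := fun t ht =>
    (hv t ht).sub (hu t (lt_of_lt_of_le hs₀ ht))
  let p : ℝ → ℝ := fun t => u t + k * coth (k * t - d)
  let g : ℝ → ℝ := fun t => p (max t s₀)
  have hg : Continuous g := by
    rw [continuous_iff_continuousAt]
    intro t
    have hm : s₀ ≤ max t s₀ := le_max_right _ _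
    have h1 : ContinuousAt p (max t s₀) :=
      ((hu _ (lt_of_lt_of_le hs₀ hm)).add (hv _ hm)).continuousAt
    have h2 : ContinuousAt (fun t : ℝ => max t s₀) t := by fun_prop
    exact ContinuousAt.comp (f := fun t : ℝ => max t s₀) h1 h2
  let F : ℝ → ℝ := fun t => ∫ x in s₀..t, g x
  have hF : ∀ t, HasDerivAt F (g t) t := fun t => (hg.integral_hasStrictDerivAt s₀ t).hasDerivAt
  have hW : ∀ t : ℝ, s₀ ≤ t →
      HasDerivAt (fun t => (k * coth (k * t - d) - u t) * Real.exp (F t))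
        (Real.exp (F t) * (r t + k ^ 2)) t := by
    intro t ht
    refine ((hw t ht).mul (hF t).exp).congr_deriv ?_
    have hgt : g t = u t + k * coth (k * t - d) := by
      simp only [g, p, max_eq_left ht]
    rw [hgt]
    linear_combination (-Real.exp (F t)) * hric t (lt_of_lt_of_le hs₀ ht)
  have hmono : MonotoneOn (fun t => (k * coth (k * t - d) - u t) * Real.exp (F t)) (Set.Ici s₀) := by
    apply monotoneOn_of_deriv_nonneg (convex_Ici s₀)
    · exact fun t ht => (hW t ht).continuousAt.continuousWithinAt
    · intro t ht
      exact (hW t (interior_subset ht)).differentiableAt.differentiableWithinAt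
    · intro t ht
      have ht' : s₀ ≤ t := interior_subset ht
      rw [(hW t ht').deriv]
      have := hr t (lt_of_lt_of_le hs₀ ht')
      exact mul_nonneg (Real.exp_pos _).le (by linarith)
  intro s hs
  have h := hmono Set.self_mem_Ici (Set.mem_Ici.mpr hs) hs
  have h0 : 0 < (k * coth (k * s₀ - d) - u s₀) * Real.exp (F s₀) :=
    mul_pos (sub_pos.mpr hinit) (Real.exp_pos _)
  exact sub_pos.mp (pos_of_mul_pos_left (lt_of_lt_of_le h0 h) (Real.exp_pos _).le)
end

section
/- Let r : ℝ → ℝ be continuous with r(s) ≥ 0 for all s ∈ ℝ. If u : ℝ → ℝ is differentiable and satisfies the Riccati equation u'(s) + u(s)² + r(s) = 0 for every s ∈ ℝ, then u(s) = 0 for all s ∈ ℝ and r(s) = 0 for all s ∈ ℝ. -/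
/-- A global subsolution of `u' = -u²` is nonnegative. -/
theorem riccati_aux_s3 (u : ℝ → ℝ) (hu : Differentiable ℝ u)
    (h : ∀ s : ℝ, deriv u s ≤ -(u s) ^ 2) (a : ℝ) : 0 ≤ u a := by
  by_contra! ha
  have hanti : Antitone u := antitone_of_deriv_nonpos hu fun s => by
    nlinarith [h s, sq_nonneg (u s)]
  have hneg : ∀ s, a ≤ s → u s < 0 := fun s hs => lt_of_le_of_lt (hanti hs) ha
  have hd : ∀ s, a ≤ s → HasDerivAt (fun s => (u s)⁻¹ - s) (-deriv u s / (u s) ^ 2 - 1) s :=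
    fun s hs => ((hu s).hasDerivAt.inv (hneg s hs).ne).sub (hasDerivAt_id s)
  have hmono : MonotoneOn (fun s => (u s)⁻¹ - s) (Set.Ici a) := by
    apply monotoneOn_of_deriv_nonneg (convex_Ici a)
    · exact fun s hs => (hd s hs).continuousAt.continuousWithinAt
    · intro s hs
      exact (hd s (interior_subset hs)).differentiableAt.differentiableWithinAt
    · intro s hs
      have hs' : a ≤ s := interior_subset hs
      rw [(hd s hs').deriv, sub_nonneg, le_div_iff₀ (sq_pos_of_neg (hneg s hs'))]
      linarith [h s]
  have hia : (u a)⁻¹ < 0 := inv_lt_zero.2 ha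
  have hab : a ≤ a - (u a)⁻¹ := by linarith
  have h1 := hmono (Set.mem_Ici.2 le_rfl) (Set.mem_Ici.2 hab) hab
  have h2 : (u (a - (u a)⁻¹))⁻¹ < 0 := inv_lt_zero.2 (hneg _ hab)
  simp only at h1
  linarith

/-- Let `r : ℝ → ℝ` be continuous with `r s ≥ 0` for all `s`.
If `u : ℝ → ℝ` is differentiable and satisfies the Riccati equation
`u' s + (u s)² + r s = 0` for every `s`, then `u ≡ 0` and `r ≡ 0`. -/
theorem riccati_nonneg_forces_zero (r u : ℝ → ℝ)
    (hrc : Continuous r) (hr : ∀ s : ℝ, 0 ≤ r s)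
    (hu : Differentiable ℝ u)
    (hric : ∀ s : ℝ, deriv u s + (u s) ^ 2 + r s = 0) :
    (∀ s : ℝ, u s = 0) ∧ (∀ s : ℝ, r s = 0) := by
  have h : ∀ s, deriv u s ≤ -(u s) ^ 2 := fun s => by linarith [hric s, hr s]
  have hv : ∀ s, HasDerivAt (fun s => -u (-s)) (deriv u (-s)) s := fun s => by
    have h1 := ((hu (-s)).hasDerivAt.comp s (hasDerivAt_neg s)).neg
    rw [mul_neg_one, neg_neg] at h1
    exact h1
  have hz : ∀ s, u s = 0 := fun s => by
    have h1 := riccati_aux_s3 u hu h s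
    have h2 := riccati_aux_s3 (fun s => -u (-s)) (fun s => (hv s).differentiableAt)
      (fun s => by rw [(hv s).deriv]; simpa using h (-s)) (-s)
    simp only [neg_neg] at h2
    linarith
  refine ⟨hz, fun s => ?_⟩
  have h0 : u = fun _ => 0 := funext hz
  have h1 := hric s
  simpa [h0] using h1
end

section
/- Assume (J) has no conjugate points. Then for all 0 < r < t: (i) d_t'(0) − d_r'(0) = ∫_r^t a(u)⁻² du > 0, and (ii) d_t(s) − d_r(s) = a(s)·∫_r^t a(u)⁻² du > 0 for every s > 0; in particular, for each fixed s > 0 the map t ↦ d_t(s) is strictly increasing on (0,∞), as is t ↦ d_t'(0). -/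
/-- `f` (with derivative `f'`) is a solution of the scalar Jacobi equation
`(J): f''(s) + κ(s)·f(s) = 0`. -/
def IsJacobiSol (κ f f' : ℝ → ℝ) : Prop :=
  (∀ s : ℝ, HasDerivAt f (f' s) s) ∧ (∀ s : ℝ, HasDerivAt f' (-(κ s * f s)) s)

/-- `(J)` has no conjugate points: every solution of `(J)` that is not identically
zero vanishes at no more than one point of `ℝ`. -/
def NoConjugatePoints (κ : ℝ → ℝ) : Prop :=
  ∀ f f' : ℝ → ℝ, IsJacobiSol κ f f' → (∃ s : ℝ, f s ≠ 0) →
    ∀ s t : ℝ, f s = 0 → f t = 0 → s = t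

/-- Assume `(J)` has no conjugate points. Then for all `0 < r < t`:
(i) `d_t'(0) − d_r'(0) = ∫_r^t a(u)⁻² du > 0`, and
(ii) `d_t(s) − d_r(s) = a(s)·∫_r^t a(u)⁻² du > 0` for every `s > 0`;
in particular, for each fixed `s > 0` the map `t ↦ d_t(s)` is strictly increasing on
`(0,∞)`, as is `t ↦ d_t'(0)`. -/
theorem dt_monotone (κ : ℝ → ℝ) (hκ : Continuous κ)
    (hnc : NoConjugatePoints κ)
    (a a' : ℝ → ℝ) (ha : IsJacobiSol κ a a') (ha0 : a 0 = 0) (ha'0 : a' 0 = 1)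
    (d d' : ℝ → ℝ → ℝ)
    (hd : ∀ t : ℝ, t ≠ 0 → IsJacobiSol κ (d t) (d' t))
    (hd0 : ∀ t : ℝ, t ≠ 0 → d t 0 = 1)
    (hdt : ∀ t : ℝ, t ≠ 0 → d t t = 0) :
    (∀ r t : ℝ, 0 < r → r < t →
        (d' t 0 - d' r 0 = ∫ u in r..t, ((a u) ^ 2)⁻¹) ∧
        0 < ∫ u in r..t, ((a u) ^ 2)⁻¹ ∧
        (∀ s : ℝ, 0 < s →
          d t s - d r s = a s * ∫ u in r..t, ((a u) ^ 2)⁻¹ ∧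
          0 < a s * ∫ u in r..t, ((a u) ^ 2)⁻¹)) ∧
    (∀ s : ℝ, 0 < s → StrictMonoOn (fun t => d t s) (Set.Ioi (0 : ℝ))) ∧
    StrictMonoOn (fun t => d' t 0) (Set.Ioi (0 : ℝ)) := by
  have hane : ∀ s : ℝ, s ≠ 0 → a s ≠ 0 := by
    intro s hs h
    by_cases hex : ∃ u, a u ≠ 0
    · exact hs (hnc a a' ha hex s 0 h ha0)
    · push Not at hex
      have h1 := ha.1 0
      have h2 : a = fun _ => (0 : ℝ) := funext hex
      rw [h2] at h1
      have := h1.unique (hasDerivAt_const (0 : ℝ) (0 : ℝ))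
      linarith
  have hac : Continuous a := continuous_iff_continuousAt.2 fun s => (ha.1 s).continuousAt
  have hapos : ∀ s : ℝ, 0 < s → 0 < a s := by
    intro s hs
    by_contra hle
    have hneg : a s < 0 := lt_of_le_of_ne (not_lt.1 hle) (hane s hs.ne')
    have h1 := (ha.1 0).tendsto_slope_zero_right
    rw [ha'0] at h1
    have h2 := h1.eventually (lt_mem_nhds (zero_lt_one : (0 : ℝ) < 1))
    obtain ⟨e, he, he0⟩ := (h2.and self_mem_nhdsWithin).exists
    have he0' : 0 < e := he0
    simp only [zero_add, ha0, sub_zero, smul_eq_mul] at he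
    have hpe : 0 < a e := by
      have := mul_pos he0' he
      rwa [mul_inv_cancel_left₀ he0'.ne'] at this
    have hsub := intermediate_value_uIcc (a := e) (b := s) (f := a) hac.continuousOn
    have hmem : (0 : ℝ) ∈ Set.uIcc (a e) (a s) := by
      rw [Set.mem_uIcc]; right; exact ⟨hneg.le, hpe.le⟩
    obtain ⟨u, hu, hu0⟩ := hsub hmem
    have hupos : 0 < u := lt_of_lt_of_le (lt_min he0' hs) hu.1
    exact hane u hupos.ne' hu0
  have key : ∀ r t : ℝ, 0 < r → r < t →
        (d' t 0 - d' r 0 = ∫ u in r..t, ((a u) ^ 2)⁻¹) ∧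
        0 < ∫ u in r..t, ((a u) ^ 2)⁻¹ ∧
        (∀ s : ℝ, 0 < s →
          d t s - d r s = a s * ∫ u in r..t, ((a u) ^ 2)⁻¹ ∧
          0 < a s * ∫ u in r..t, ((a u) ^ 2)⁻¹) := by
    intro r t hr hrt
    have ht : 0 < t := hr.trans hrt
    have hmem : ∀ u ∈ Set.uIcc r t, 0 < u := fun u hu => by
      rw [Set.uIcc_of_le hrt.le] at hu; exact hr.trans_le hu.1
    have hcont : ContinuousOn (fun u => ((a u) ^ 2)⁻¹) (Set.uIcc r t) :=
      ContinuousOn.inv₀ (hac.pow 2).continuousOn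
        fun u hu => pow_ne_zero 2 (hapos u (hmem u hu)).ne'
    have hdT := hd t ht.ne'
    have hdR := hd r hr.ne'
    have hW : ∀ u, d' t u * a u - d t u * a' u = -1 := by
      have hder : ∀ u, HasDerivAt (fun u => d' t u * a u - d t u * a' u) 0 u := by
        intro u
        refine (((hdT.2 u).mul (ha.1 u)).sub ((hdT.1 u).mul (ha.2 u))).congr_deriv ?_
        ring
      intro u
      have := is_const_of_deriv_eq_zero (fun u => (hder u).differentiableAt)
        (fun u => (hder u).deriv) u 0
      rw [this, ha0, ha'0, hd0 t ht.ne']; ring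
    have hint : ∫ u in r..t, ((a u) ^ 2)⁻¹ = d t r / a r := by
      have := intervalIntegral.integral_eq_sub_of_hasDerivAt
        (f := fun u => -(d t u / a u)) (f' := fun u => ((a u) ^ 2)⁻¹) (a := r) (b := t)
        (fun u hu => by
          have hne := (hapos u (hmem u hu)).ne'
          refine ((hdT.1 u).div (ha.1 u) hne).neg.congr_deriv ?_
          rw [hW u, neg_div, neg_neg, one_div]) hcont.intervalIntegrable
      rw [this, hdt t ht.ne']; ring
    have hpos : 0 < ∫ u in r..t, ((a u) ^ 2)⁻¹ := by
      apply intervalIntegral.intervalIntegral_pos_of_pos_on hcont.intervalIntegrable _ hrt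
      intro u hu
      exact inv_pos.2 (pow_pos (hapos u (hr.trans hu.1)) 2)
    have hz : ∀ s, d t s - d r s - (∫ u in r..t, ((a u) ^ 2)⁻¹) * a s = 0 := by
      by_contra hex
      push Not at hex
      have := hnc (fun s => d t s - d r s - (∫ u in r..t, ((a u) ^ 2)⁻¹) * a s)
        (fun s => d' t s - d' r s - (∫ u in r..t, ((a u) ^ 2)⁻¹) * a' s)
        ⟨fun s => ((hdT.1 s).sub (hdR.1 s)).sub ((ha.1 s).const_mul _), fun s => by
          refine (((hdT.2 s).sub (hdR.2 s)).sub ((ha.2 s).const_mul _)).congr_deriv ?_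
          ring⟩ hex r 0
        (by
          have := (hapos r hr).ne'
          rw [hint, hdt r hr.ne']; field_simp; ring)
        (by simp [ha0, hd0 t ht.ne', hd0 r hr.ne'])
      exact hr.ne' this
    refine ⟨?_, hpos, fun s hs => ⟨?_, mul_pos (hapos s hs) hpos⟩⟩
    · have h1 := ((hdT.1 0).sub (hdR.1 0)).sub
        ((ha.1 0).const_mul (∫ u in r..t, ((a u) ^ 2)⁻¹))
      have h2 : (d t - d r - fun s => (∫ u in r..t, ((a u) ^ 2)⁻¹) * a s)
          = fun _ => (0 : ℝ) := funext hz
      rw [h2] at h1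
      have := h1.unique (hasDerivAt_const (0 : ℝ) (0 : ℝ))
      rw [ha'0] at this
      linarith
    · have := hz s
      linarith
  refine ⟨key, fun s hs r hr t _ hrt => ?_, fun r hr t _ hrt => ?_⟩
  · obtain ⟨h1, h2⟩ := (key r t hr hrt).2.2 s hs
    simp only []
    linarith
  · obtain ⟨h1, h2, _⟩ := key r t hr hrt
    simp only []
    linarith
end

section
/- Assume (J) has no conjugate points. Then for every t > 0 and every q > 0, d_t'(0) < d_{−q}'(0). -/
/-- Assume `(J)` has no conjugate points. Then for every `t > 0` and
every `q > 0`, `d_t'(0) < d_{−q}'(0)`. -/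
theorem dt_deriv_lt_dneg (κ : ℝ → ℝ) (hκ : Continuous κ)
    (hnc : NoConjugatePoints κ)
    (d d' : ℝ → ℝ → ℝ)
    (hd : ∀ t : ℝ, t ≠ 0 → IsJacobiSol κ (d t) (d' t))
    (hd0 : ∀ t : ℝ, t ≠ 0 → d t 0 = 1)
    (hdt : ∀ t : ℝ, t ≠ 0 → d t t = 0) :
    ∀ t : ℝ, 0 < t → ∀ q : ℝ, 0 < q → d' t 0 < d' (-q) 0 := by
  intro t ht q hq
  have ht0 : t ≠ 0 := ht.ne'
  have hq0 : -q ≠ 0 := neg_ne_zero.mpr hq.ne'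
  obtain ⟨hu, hu'⟩ := hd t ht0
  have hv_sol := hd (-q) hq0
  have hv := hv_sol.1
  have hv' := hv_sol.2
  have hu0 := hd0 t ht0
  have hv0 := hd0 (-q) hq0
  have hut := hdt t ht0
  have hvq := hdt (-q) hq0
  -- the second solution has no zeros on `[0, t]`
  have hvne : ∀ s : ℝ, 0 ≤ s → d (-q) s ≠ 0 := by
    intro s hs h
    have := hnc _ _ hv_sol ⟨0, by rw [hv0]; exact one_ne_zero⟩ s (-q) h hvq
    linarith
  -- the Wronskian is constant
  have hW : ∀ s : ℝ, HasDerivAt (fun x => d' t x * d (-q) x - d t x * d' (-q) x) 0 s := by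
    intro s
    have h := ((hu' s).mul (hv s)).sub ((hu s).mul (hv' s))
    refine HasDerivAt.congr_deriv h ?_
    ring
  have hWc : ∀ s : ℝ, d' t s * d (-q) s - d t s * d' (-q) s = d' t 0 - d' (-q) 0 := by
    intro s
    have h := is_const_of_deriv_eq_zero (fun x => (hW x).differentiableAt)
      (fun x => (hW x).deriv) s 0
    simp only [hu0, hv0] at h
    linarith
  -- mean value theorem for the quotient
  have hQ : ∀ s : ℝ, 0 ≤ s → HasDerivAt (fun x => d t x / d (-q) x)
      ((d' t 0 - d' (-q) 0) / d (-q) s ^ 2) s := by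
    intro s hs
    have h := (hu s).div (hv s) (hvne s hs)
    rw [hWc s] at h
    exact h
  obtain ⟨c, hc, hceq⟩ := exists_hasDerivAt_eq_slope (fun x => d t x / d (-q) x)
    (fun s => (d' t 0 - d' (-q) 0) / d (-q) s ^ 2) ht
    (fun s hs => (hQ s hs.1).continuousAt.continuousWithinAt)
    (fun s hs => hQ s hs.1.le)
  simp only [hut, hu0, hv0] at hceq
  have hneg : (d' t 0 - d' (-q) 0) / d (-q) c ^ 2 < 0 := by
    rw [hceq]
    apply div_neg_of_neg_of_pos <;> norm_num
    exact ht
  have hpos : 0 < d (-q) c ^ 2 := by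
    have := hvne c hc.1.le
    positivity
  have := (div_lt_iff₀ hpos).mp hneg
  linarith
end

section
/- Assume (J) has no conjugate points. Then the limit lim_{t→∞} d_t'(0) exists; that is, the function t ↦ d_t'(0), defined for t > 0, converges to a finite limit as t → ∞. -/
theorem jac_ivt (f : ℝ → ℝ) (hf : Continuous f) (p x : ℝ) (hp : 0 < f p) (hx : f x ≤ 0) :
    ∃ z ∈ Set.uIcc p x, f z = 0 := by
  have h := intermediate_value_uIcc (a := p) (b := x) hf.continuousOn
  have h0 : (0 : ℝ) ∈ Set.uIcc (f p) (f x) := Set.mem_uIcc.2 (Or.inr ⟨hx, hp.le⟩)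
  obtain ⟨z, hz, hz'⟩ := h h0
  exact ⟨z, hz, hz'⟩

theorem jac_cont {κ f f' : ℝ → ℝ} (h : IsJacobiSol κ f f') : Continuous f :=
  continuous_iff_continuousAt.2 fun s => (h.1 s).continuousAt

theorem jac_sub {κ f f' g g' : ℝ → ℝ} (h : IsJacobiSol κ f f') (k : IsJacobiSol κ g g') :
    IsJacobiSol κ (fun s => f s - g s) (fun s => f' s - g' s) := by
  refine ⟨fun s => (h.1 s).sub (k.1 s), fun s => ?_⟩
  refine ((h.2 s).sub (k.2 s)).congr_deriv ?_
  ring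

theorem jac_deriv_nonneg {κ f f' : ℝ → ℝ} (hnc : NoConjugatePoints κ) (h : IsJacobiSol κ f f')
    (h0 : f 0 = 0) (p : ℝ) (hp : 0 < p) (hfp : 0 < f p) : 0 ≤ f' 0 := by
  have hpos : ∀ x, 0 < x → 0 < f x := by
    intro x hx
    by_contra hneg
    obtain ⟨z, hz, hz0⟩ := jac_ivt f (jac_cont h) p x hfp (not_lt.1 hneg)
    have hzz := hnc f f' h ⟨p, hfp.ne'⟩ 0 z h0 hz0
    rcases Set.mem_uIcc.1 hz with hh | hh <;> linarith [hh.1]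
  have ht := (h.1 0).tendsto_slope.mono_left
    (nhdsWithin_mono (0 : ℝ) (s := Set.Ioi 0) (fun x hx => ne_of_gt hx))
  refine ge_of_tendsto ht ?_
  filter_upwards [self_mem_nhdsWithin] with x hx
  have hx' : (0 : ℝ) < x := hx
  rw [slope_def_field, h0, sub_zero, sub_zero]
  exact (div_pos (hpos x hx') hx').le

theorem jac_pos {κ f f' : ℝ → ℝ} (hnc : NoConjugatePoints κ) (h : IsJacobiSol κ f f')
    (h0 : f 0 = 1) (q x : ℝ) (hx : 0 < x) (hq : f q = 0) (hqx : q < 0 ∨ x < q) : 0 < f x := by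
  have h1 : 0 < f 0 := by rw [h0]; exact one_pos
  by_contra hneg
  obtain ⟨z, hz, hz0⟩ := jac_ivt f (jac_cont h) 0 x h1 (not_lt.1 hneg)
  have hzz := hnc f f' h ⟨0, h1.ne'⟩ q z hq hz0
  rw [Set.uIcc_of_le hx.le] at hz
  rcases hqx with hh | hh <;> linarith [hz.1, hz.2]

/-- Assume `(J)` has no conjugate points. Then the limit
`lim_{t→∞} d_t'(0)` exists (as a finite number). -/
theorem dt_deriv_limit_exists (κ : ℝ → ℝ) (hκ : Continuous κ)
    (hnc : NoConjugatePoints κ)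
    (d d' : ℝ → ℝ → ℝ)
    (hd : ∀ t : ℝ, t ≠ 0 → IsJacobiSol κ (d t) (d' t))
    (hd0 : ∀ t : ℝ, t ≠ 0 → d t 0 = 1)
    (hdt : ∀ t : ℝ, t ≠ 0 → d t t = 0) :
    ∃ L : ℝ, Filter.Tendsto (fun t => d' t 0) Filter.atTop (nhds L) := by
  have key : ∀ s t : ℝ, 0 < s → t ≠ 0 → (t < 0 ∨ s < t) → d' s 0 ≤ d' t 0 := by
    intro s t hs ht hst
    have hf := jac_sub (hd t ht) (hd s hs.ne')
    have h1 := jac_pos hnc (hd t ht) (hd0 t ht) t s hs (hdt t ht) hst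
    have h2 := jac_deriv_nonneg hnc hf (by simp [hd0 t ht, hd0 s hs.ne']) s hs
      (by simpa [hdt s hs.ne'] using h1)
    linarith
  have hpos : ∀ t : ℝ, 0 < max t 1 := fun t => lt_of_lt_of_le one_pos (le_max_right t 1)
  have hmono : Monotone (fun t : ℝ => d' (max t 1) 0) := by
    intro s t hst
    have hle : max s 1 ≤ max t 1 := max_le_max_right 1 hst
    rcases hle.eq_or_lt with he | hl
    · exact le_of_eq (by simp only [he])
    · exact key _ _ (hpos s) (hpos t).ne' (Or.inr hl)
  have hbdd : BddAbove (Set.range (fun t : ℝ => d' (max t 1) 0)) := by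
    refine ⟨d' (-1) 0, ?_⟩
    rintro _ ⟨t, rfl⟩
    exact key _ _ (hpos t) (by norm_num) (Or.inl (by norm_num))
  refine ⟨_, (tendsto_atTop_ciSup hmono hbdd).congr' ?_⟩
  filter_upwards [Filter.eventually_ge_atTop (1 : ℝ)] with t ht
  rw [max_eq_left ht]
end

section
/- Assume (J) has no conjugate points, and let d be the solution of (J) with d(0) = 1 and d'(0) = lim_{t→∞} d_t'(0) (this limit exists). Then for every s ∈ ℝ, d_t(s) → d(s) as t → ∞. -/
lemma jacobi_bound_nonneg (κ : ℝ → ℝ) (hκ : Continuous κ) (s : ℝ) (hs : 0 ≤ s) :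
    ∃ C : ℝ, ∀ f f' : ℝ → ℝ, IsJacobiSol κ f f' → f 0 = 0 → |f s| ≤ C * |f' 0| := by
  obtain ⟨M, hM⟩ := (isCompact_Icc (a := (0:ℝ)) (b := s)).exists_bound_of_continuousOn hκ.continuousOn
  refine ⟨Real.exp (max 1 M * (s - 0)), fun f f' hf h0 => ?_⟩
  have hder : ∀ x : ℝ, HasDerivAt (fun y => (f y, f' y)) (f' x, -(κ x * f x)) x :=
    fun x => (hf.1 x).prodMk (hf.2 x)
  have key := norm_le_gronwallBound_of_norm_deriv_right_le (f := fun y => (f y, f' y))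
    (f' := fun x => (f' x, -(κ x * f x))) (δ := |f' 0|) (K := max 1 M) (ε := 0) (a := 0) (b := s)
    (fun x _ => (hder x).continuousAt.continuousWithinAt)
    (fun x _ => (hder x).hasDerivWithinAt)
    (by simp [h0, Prod.norm_def])
    (by
      intro x hx
      have hMx := hM x ⟨hx.1, hx.2.le⟩
      have h1 : |f x| ≤ ‖(f x, f' x)‖ := norm_fst_le (f x, f' x)
      have h2 : |f' x| ≤ ‖(f x, f' x)‖ := norm_snd_le (f x, f' x)
      have hn : 0 ≤ ‖(f x, f' x)‖ := norm_nonneg _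
      have h3 : (1:ℝ) ≤ max 1 M := le_max_left _ _
      have h4 : |κ x| ≤ max 1 M := hMx.trans (le_max_right _ _)
      rw [add_zero, Prod.norm_def]
      refine max_le ?_ ?_
      · simp only [Real.norm_eq_abs]
        nlinarith
      · simp only [Real.norm_eq_abs, abs_neg, abs_mul]
        exact mul_le_mul h4 h1 (abs_nonneg _) (by linarith))
    s ⟨hs, le_rfl⟩
  rw [gronwallBound_ε0] at key
  have h1 : |f s| ≤ ‖(f s, f' s)‖ := norm_fst_le (f s, f' s)
  rw [mul_comm]
  exact h1.trans key

lemma jacobi_bound (κ : ℝ → ℝ) (hκ : Continuous κ) (s : ℝ) :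
    ∃ C : ℝ, ∀ f f' : ℝ → ℝ, IsJacobiSol κ f f' → f 0 = 0 → |f s| ≤ C * |f' 0| := by
  rcases le_total 0 s with hs | hs
  · exact jacobi_bound_nonneg κ hκ s hs
  · obtain ⟨C, hC⟩ := jacobi_bound_nonneg (fun x => κ (-x)) (hκ.comp continuous_neg) (-s)
      (by linarith)
    refine ⟨C, fun f f' hf h0 => ?_⟩
    have := hC (fun x => f (-x)) (fun x => -f' (-x)) ⟨fun x => ?_, fun x => ?_⟩ (by simpa using h0)
    · simpa using this
    · have h := (hf.1 (-x)).comp x (hasDerivAt_neg x)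
      simpa [Function.comp_def] using h
    · have h := ((hf.2 (-x)).comp x (hasDerivAt_neg x)).neg
      have e : -(-(κ (-x) * f (-x)) * -1) = -(κ (-x) * f (-x)) := by ring
      rw [e] at h
      exact h

/-- Assume `(J)` has no conjugate points, and let `dd` be the solution
of `(J)` with `dd 0 = 1` and `dd' 0 = lim_{t→∞} d_t'(0)`. Then for every `s`,
`d_t(s) → dd(s)` as `t → ∞`. -/
theorem dt_tendsto_d (κ : ℝ → ℝ) (hκ : Continuous κ)
    (hnc : NoConjugatePoints κ)
    (d d' : ℝ → ℝ → ℝ)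
    (hd : ∀ t : ℝ, t ≠ 0 → IsJacobiSol κ (d t) (d' t))
    (hd0 : ∀ t : ℝ, t ≠ 0 → d t 0 = 1)
    (hdt : ∀ t : ℝ, t ≠ 0 → d t t = 0)
    (L : ℝ) (hL : Filter.Tendsto (fun t => d' t 0) Filter.atTop (nhds L))
    (dd dd' : ℝ → ℝ) (hdd : IsJacobiSol κ dd dd')
    (hdd0 : dd 0 = 1) (hdd'0 : dd' 0 = L) :
    ∀ s : ℝ, Filter.Tendsto (fun t => d t s) Filter.atTop (nhds (dd s)) := by
  intro s
  obtain ⟨C, hC⟩ := jacobi_bound κ hκ s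
  have hlim : Filter.Tendsto (fun t => C * |d' t 0 - L|) Filter.atTop (nhds 0) := by
    simpa using ((hL.sub_const L).abs).const_mul C
  rw [tendsto_iff_dist_tendsto_zero]
  refine squeeze_zero' (Filter.Eventually.of_forall fun _ => dist_nonneg) ?_ hlim
  filter_upwards [Filter.eventually_ne_atTop 0] with t ht
  have := hC (fun x => d t x - dd x) (fun x => d' t x - dd' x)
    ⟨fun x => ((hd t ht).1 x).sub (hdd.1 x), fun x => ?_⟩ (by simp [hd0 t ht, hdd0])
  · simpa [Real.dist_eq, hdd'0] using this
  · have h := ((hd t ht).2 x).sub (hdd.2 x)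
    have e : -(κ x * d t x) - -(κ x * dd x) = -(κ x * (d t x - dd x)) := by ring
    rw [e] at h
    exact h
end

section
/- Assume (J) has no conjugate points. Then: (1) the limit lim_{t→−∞} d_t'(0) exists; (2) if d̄ denotes the solution of (J) with d̄(0) = 1 and d̄'(0) = lim_{t→−∞} d_t'(0), then for every s ∈ ℝ, d_t(s) → d̄(s) as t → −∞; and (3) d̄(s) ≠ 0 for every s ∈ ℝ. -/
theorem jac_comb {κ f f' g g' : ℝ → ℝ} (hf : IsJacobiSol κ f f') (hg : IsJacobiSol κ g g')
    (x y : ℝ) : IsJacobiSol κ (fun s => x * f s + y * g s) (fun s => x * f' s + y * g' s) := by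
  refine ⟨fun s => ((hf.1 s).const_mul x).add ((hg.1 s).const_mul y), fun s => ?_⟩
  exact (((hf.2 s).const_mul x).add ((hg.2 s).const_mul y)).congr_deriv (by ring)

theorem jac_wronskian {κ f f' g g' : ℝ → ℝ} (hf : IsJacobiSol κ f f') (hg : IsJacobiSol κ g g')
    (s t : ℝ) : f s * g' s - f' s * g s = f t * g' t - f' t * g t := by
  have h : ∀ s, HasDerivAt (fun s => f s * g' s - f' s * g s) 0 s := by
    intro s
    exact (((hf.1 s).mul (hg.2 s)).sub ((hf.2 s).mul (hg.1 s))).congr_deriv (by ring)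
  exact is_const_of_deriv_eq_zero (fun s => (h s).differentiableAt) (fun s => (h s).deriv) s t

theorem jac_continuous {κ f f' : ℝ → ℝ} (hf : IsJacobiSol κ f f') : Continuous f :=
  continuous_iff_continuousAt.2 fun s => (hf.1 s).continuousAt

theorem jac_pos_s11 {κ f f' : ℝ → ℝ} (hnc : NoConjugatePoints κ) (hf : IsJacobiSol κ f f')
    {p q s : ℝ} (hp : 0 < f p) (hq : f q = 0) (hs : q ∉ Set.uIcc p s) : 0 < f s := by
  by_contra hcon
  push Not at hcon
  have h := intermediate_value_uIcc (jac_continuous hf).continuousOn (a := p) (b := s)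
  have h0 : (0 : ℝ) ∈ Set.uIcc (f p) (f s) := by
    rw [Set.uIcc_of_ge (by linarith)]
    exact ⟨hcon, hp.le⟩
  obtain ⟨r, hr, hr0⟩ := h h0
  exact hs (hnc f f' hf ⟨p, hp.ne'⟩ r q hr0 hq ▸ hr)

theorem jac_a {κ : ℝ → ℝ} (hnc : NoConjugatePoints κ) {b b' e e' : ℝ → ℝ}
    (hb : IsJacobiSol κ b b') (he : IsJacobiSol κ e e')
    (hb0 : b 0 = 1) (he0 : e 0 = 1) (hb1 : b 1 = 0) (he1 : e (-1) = 0) :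
    ∃ a a' : ℝ → ℝ, IsJacobiSol κ a a' ∧ a 0 = 0 ∧ a' 0 = 1 ∧ (∀ s, 0 < s → 0 < a s) ∧
      (∀ s, s < 0 → a s < 0) := by
  have hbpos : ∀ s, s < 1 → 0 < b s := fun s hs =>
    jac_pos_s11 hnc hb (p := 0) (q := 1) (by rw [hb0]; norm_num) hb1 (by
      intro h
      rw [Set.mem_uIcc] at h
      rcases h with h | h <;> linarith [h.1, h.2])
  have hepos : ∀ s, -1 < s → 0 < e s := fun s hs =>
    jac_pos_s11 hnc he (p := 0) (q := -1) (by rw [he0]; norm_num) he1 (by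
      intro h
      rw [Set.mem_uIcc] at h
      rcases h with h | h <;> linarith [h.1, h.2])
  have hc : 0 < e' 0 - b' 0 := by
    have hder : ∀ s, s < 1 → HasDerivAt (fun s => e s / b s)
        ((e' s * b s - e s * b' s) / (b s) ^ 2) s := fun s hs =>
      (he.1 s).div (hb.1 s) (hbpos s hs).ne'
    obtain ⟨r, hr, hr'⟩ := exists_hasDerivAt_eq_slope (fun s => e s / b s)
      (fun s => (e' s * b s - e s * b' s) / (b s) ^ 2) (a := -1) (b := 0) (by norm_num)
      (fun s hs => (hder s (by linarith [hs.2])).continuousAt.continuousWithinAt)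
      (fun s hs => hder s (by linarith [hs.2]))
    have hw := jac_wronskian hb he r 0
    have hpr := hbpos r (by linarith [hr.2])
    simp only [hb0, he0, he1] at hr' hw
    norm_num at hr'
    rw [div_eq_one_iff_eq (by positivity)] at hr'
    nlinarith [pow_pos hpr 2]
  set c := e' 0 - b' 0 with hcdef
  have ha := jac_comb he hb (1 / c) (-(1 / c))
  have hci : 0 < 1 / c := by positivity
  have ha0 : 1 / c * e 0 + -(1 / c) * b 0 = 0 := by rw [he0, hb0]; ring
  refine ⟨_, _, ha, ha0, ?_, ?_, ?_⟩
  · show 1 / c * e' 0 + -(1 / c) * b' 0 = 1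
    have : 1 / c * e' 0 + -(1 / c) * b' 0 = 1 / c * c := by rw [hcdef]; ring
    rw [this]; field_simp
  · intro s hs
    refine jac_pos_s11 hnc ha (p := 1) (q := 0) ?_ ha0 ?_
    · show 0 < 1 / c * e 1 + -(1 / c) * b 1
      rw [hb1]
      have := mul_pos hci (hepos 1 (by norm_num))
      linarith
    · intro h
      rw [Set.mem_uIcc] at h
      rcases h with h | h <;> linarith [h.1, h.2]
  · intro s hs
    have ha2 := jac_comb he hb (-(1 / c)) (1 / c)
    have ha20 : -(1 / c) * e 0 + (1 / c) * b 0 = 0 := by rw [he0, hb0]; ring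
    have := jac_pos_s11 hnc ha2 (p := -1) (q := 0) (s := s) (by
      show 0 < -(1 / c) * e (-1) + (1 / c) * b (-1)
      rw [he1]
      have := mul_pos hci (hbpos (-1) (by norm_num))
      linarith) ha20 (by
        intro h
        rw [Set.mem_uIcc] at h
        rcases h with h | h <;> linarith [h.1, h.2])
    show 1 / c * e s + -(1 / c) * b s < 0
    linarith

theorem jac_diff {κ a a' f f' g g' : ℝ → ℝ} (ha : IsJacobiSol κ a a') (ha0 : a 0 = 0)
    (ha1 : a' 0 = 1) (hf : IsJacobiSol κ f f') (hg : IsJacobiSol κ g g')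
    (hf0 : f 0 = 1) (hg0 : g 0 = 1) (s : ℝ) : f s = g s + (f' 0 - g' 0) * a s := by
  have h1 := jac_wronskian hf hg s 0
  have h2 := jac_wronskian hf ha s 0
  have h3 := jac_wronskian hg ha s 0
  rw [hf0, hg0] at h1
  rw [hf0, ha0, ha1] at h2
  rw [hg0, ha0, ha1] at h3
  linear_combination (-f s) * h3 + (g s) * h2 - (a s) * h1

/-- Assume `(J)` has no conjugate points. Then:
(1) the limit `lim_{t→−∞} d_t'(0)` exists; (2) if `dbar` is the solution of `(J)` with
`dbar 0 = 1` and `dbar' 0 = lim_{t→−∞} d_t'(0)`, then for every `s`,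
`d_t(s) → dbar(s)` as `t → −∞`; and (3) `dbar(s) ≠ 0` for every `s`. -/
theorem dbar_exists_and_nonvanishing (κ : ℝ → ℝ) (hκ : Continuous κ)
    (hnc : NoConjugatePoints κ)
    (d d' : ℝ → ℝ → ℝ)
    (hd : ∀ t : ℝ, t ≠ 0 → IsJacobiSol κ (d t) (d' t))
    (hd0 : ∀ t : ℝ, t ≠ 0 → d t 0 = 1)
    (hdt : ∀ t : ℝ, t ≠ 0 → d t t = 0) :
    (∃ L : ℝ, Filter.Tendsto (fun t => d' t 0) Filter.atBot (nhds L)) ∧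
    (∀ L : ℝ, Filter.Tendsto (fun t => d' t 0) Filter.atBot (nhds L) →
      ∀ dbar dbar' : ℝ → ℝ, IsJacobiSol κ dbar dbar' →
        dbar 0 = 1 → dbar' 0 = L →
        (∀ s : ℝ, Filter.Tendsto (fun t => d t s) Filter.atBot (nhds (dbar s))) ∧
        (∀ s : ℝ, dbar s ≠ 0)) := by
  have hda : ∃ a a' : ℝ → ℝ, IsJacobiSol κ a a' ∧ a 0 = 0 ∧ a' 0 = 1 ∧ (∀ s, 0 < s → 0 < a s) ∧
      (∀ s, s < 0 → a s < 0) :=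
    jac_a hnc (hd 1 (by norm_num)) (hd (-1) (by norm_num)) (hd0 1 (by norm_num))
      (hd0 (-1) (by norm_num)) (hdt 1 (by norm_num)) (hdt (-1) (by norm_num))
  obtain ⟨a, a', ha, ha0, ha1, hap, han⟩ := hda
  have hposR : ∀ t s, t < 0 → t < s → 0 < d t s := fun t s ht hs =>
    jac_pos_s11 hnc (hd t ht.ne) (p := 0) (q := t) (by rw [hd0 t ht.ne]; norm_num) (hdt t ht.ne) (by
      intro h
      rw [Set.mem_uIcc] at h
      rcases h with h | h <;> linarith [h.1, h.2])
  have hposL : ∀ t s, 0 < t → s < t → 0 < d t s := fun t s ht hs =>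
    jac_pos_s11 hnc (hd t ht.ne') (p := 0) (q := t) (by rw [hd0 t ht.ne']; norm_num)
      (hdt t ht.ne') (by
      intro h
      rw [Set.mem_uIcc] at h
      rcases h with h | h <;> linarith [h.1, h.2])
  have hdiff : ∀ t T, t ≠ 0 → T ≠ 0 → d t T = (d' t 0 - d' T 0) * a T := by
    intro t T ht hT
    have := jac_diff ha ha0 ha1 (hd t ht) (hd T hT) (hd0 t ht) (hd0 T hT) T
    rw [hdt T hT] at this
    linarith
  have hneg : ∀ t T, t < T → T < 0 → d' t 0 < d' T 0 := by
    intro t T h1 h2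
    have h := hposR t T (by linarith) h1
    rw [hdiff t T (by linarith) h2.ne] at h
    nlinarith [han T h2]
  have hmix : ∀ t T, t < 0 → 0 < T → d' T 0 < d' t 0 := by
    intro t T h1 h2
    have h := hposR t T h1 (by linarith)
    rw [hdiff t T h1.ne h2.ne'] at h
    nlinarith [hap T h2]
  have hpp : ∀ t T, 0 < T → T < t → d' T 0 < d' t 0 := by
    intro t T h1 h2
    have h := hposL t T (by linarith) h2
    rw [hdiff t T (by linarith) h1.ne'] at h
    nlinarith [hap T h1]
  refine ⟨?_, ?_⟩
  · have hmono : Monotone (fun t => d' (min t (-1)) 0) := by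
      intro t T h
      rcases (min_le_min_right (-1 : ℝ) h).eq_or_lt with h' | h'
      · simp only [h', le_refl]
      · exact (hneg _ _ h' (by linarith [min_le_right T (-1 : ℝ)])).le
    have hbdd : BddBelow (Set.range (fun t => d' (min t (-1)) 0)) := by
      refine ⟨d' 1 0, ?_⟩
      rintro _ ⟨t, rfl⟩
      exact (hmix _ 1 (by linarith [min_le_right t (-1 : ℝ)]) one_pos).le
    refine ⟨_, (tendsto_atBot_ciInf hmono hbdd).congr' ?_⟩
    filter_upwards [Filter.eventually_le_atBot (-1 : ℝ)] with t ht
    rw [min_eq_left ht]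
  · intro L hL D D' hD hD0 hD1
    refine ⟨fun s => ?_, fun s hs => ?_⟩
    · have h : Filter.Tendsto (fun t => D s + (d' t 0 - D' 0) * a s) Filter.atBot
          (nhds (D s + (L - D' 0) * a s)) :=
        ((hL.sub_const _).mul_const _).const_add _
      rw [hD1, sub_self, zero_mul, add_zero] at h
      refine h.congr' ?_
      filter_upwards [Filter.eventually_lt_atBot (0 : ℝ)] with t ht
      rw [jac_diff ha ha0 ha1 (hd t ht.ne) hD (hd0 t ht.ne) hD0 s, hD1]
    · rcases lt_trichotomy s 0 with h | h | h
      · have e := jac_diff ha ha0 ha1 hD (hd s h.ne) hD0 (hd0 s h.ne) s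
        rw [hs, hdt s h.ne, hD1] at e
        have h1 : L ≤ d' (s - 1) 0 := by
          refine le_of_tendsto hL ?_
          filter_upwards [Filter.eventually_lt_atBot (s - 1)] with t ht
          exact (hneg t (s - 1) ht (by linarith)).le
        have h2 := hneg (s - 1) s (by linarith) h
        nlinarith [han s h]
      · rw [h, hD0] at hs
        norm_num at hs
      · have e := jac_diff ha ha0 ha1 hD (hd s h.ne') hD0 (hd0 s h.ne') s
        rw [hs, hdt s h.ne', hD1] at e
        have h1 : d' (s + 1) 0 ≤ L := by
          refine ge_of_tendsto hL ?_
          filter_upwards [Filter.eventually_lt_atBot 0] with t ht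
          exact (hmix t (s + 1) ht (by linarith)).le
        have h2 := hpp (s + 1) s h (by linarith)
        nlinarith [hap s h]
end

section
/- Assume (J) has no conjugate points, and let d be the solution of (J) with d(0) = 1 and d'(0) = lim_{t→∞} d_t'(0) (this limit exists). Then for every s > 0 the improper integral ∫_s^∞ a(u)⁻² du converges, and d(s) = a(s)·∫_s^∞ a(u)⁻² du. -/
open MeasureTheory

/-- Assume `(J)` has no conjugate points, and let `dd` be the solution
of `(J)` with `dd 0 = 1` and `dd' 0 = lim_{t→∞} d_t'(0)`. Then for every `s > 0` the
improper integral `∫_s^∞ a(u)⁻² du` converges, and `dd(s) = a(s)·∫_s^∞ a(u)⁻² du`. -/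
theorem d_integral_formula (κ : ℝ → ℝ) (hκ : Continuous κ)
    (hnc : NoConjugatePoints κ)
    (a a' : ℝ → ℝ) (ha : IsJacobiSol κ a a') (ha0 : a 0 = 0) (ha'0 : a' 0 = 1)
    (d d' : ℝ → ℝ → ℝ)
    (hd : ∀ t : ℝ, t ≠ 0 → IsJacobiSol κ (d t) (d' t))
    (hd0 : ∀ t : ℝ, t ≠ 0 → d t 0 = 1)
    (hdt : ∀ t : ℝ, t ≠ 0 → d t t = 0)
    (L : ℝ) (hL : Filter.Tendsto (fun t => d' t 0) Filter.atTop (nhds L))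
    (dd dd' : ℝ → ℝ) (hdd : IsJacobiSol κ dd dd')
    (hdd0 : dd 0 = 1) (hdd'0 : dd' 0 = L) :
    ∀ s : ℝ, 0 < s →
      IntegrableOn (fun u => ((a u) ^ 2)⁻¹) (Set.Ioi s) ∧
      dd s = a s * ∫ u in Set.Ioi s, ((a u) ^ 2)⁻¹ := by
  have hane : ∃ s, a s ≠ 0 := by
    by_contra h
    push Not at h
    have h1 : a = fun _ => 0 := funext h
    have h2 := ha.1 0
    rw [h1, ha'0] at h2
    exact one_ne_zero (h2.unique (hasDerivAt_const (0 : ℝ) (0 : ℝ)))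
  have hapos : ∀ t : ℝ, 0 < t → a t ≠ 0 := fun t ht h =>
    ht.ne (hnc a a' ha hane 0 t ha0 h)
  have key : ∀ t : ℝ, 0 < t → dd t / a t = L - d' t 0 := by
    intro t ht
    have hat := hapos t ht
    have hsol : IsJacobiSol κ (fun s => dd s - d t s - dd t / a t * a s)
        (fun s => dd' s - d' t s - dd t / a t * a' s) := by
      constructor
      · intro s
        exact ((hdd.1 s).sub ((hd t ht.ne').1 s)).sub ((ha.1 s).const_mul _)
      · intro s
        refine (((hdd.2 s).sub ((hd t ht.ne').2 s)).sub ((ha.2 s).const_mul _)).congr_deriv ?_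
        ring
    have hz : ∀ s, dd s - d t s - dd t / a t * a s = 0 := by
      by_contra h
      push Not at h
      refine ht.ne (hnc _ _ hsol h 0 t ?_ ?_)
      · simp [hdd0, hd0 t ht.ne', ha0]
      · simp only [hdt t ht.ne']
        field_simp
        ring
    have h2 := hsol.1 0
    rw [show (fun s => dd s - d t s - dd t / a t * a s) = fun _ => (0 : ℝ) from funext hz] at h2
    have h3 := h2.unique (hasDerivAt_const (0 : ℝ) (0 : ℝ))
    simp only [hdd'0, ha'0] at h3
    linarith
  have hW : ∀ s, dd' s * a s - dd s * a' s = -1 := by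
    have hder : ∀ s, HasDerivAt (fun s => dd' s * a s - dd s * a' s) 0 s := by
      intro s
      refine (((hdd.2 s).mul (ha.1 s)).sub ((hdd.1 s).mul (ha.2 s))).congr_deriv ?_
      ring
    intro s
    have := is_const_of_deriv_eq_zero (fun s => (hder s).differentiableAt)
      (fun s => (hder s).deriv) s 0
    simp only [ha0, hdd0, ha'0] at this
    linarith
  have hlim : Filter.Tendsto (fun t => -(dd t / a t)) Filter.atTop (nhds 0) := by
    have h1 : Filter.Tendsto (fun t => -(L - d' t 0)) Filter.atTop (nhds 0) := by
      simpa using (hL.const_sub L).neg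
    refine h1.congr' ?_
    filter_upwards [Filter.eventually_gt_atTop 0] with t ht
    rw [key t ht]
  have hderiv : ∀ t : ℝ, 0 < t → HasDerivAt (fun t => -(dd t / a t)) (((a t) ^ 2)⁻¹) t := by
    intro t ht
    refine ((hdd.1 t).div (ha.1 t) (hapos t ht)).neg.congr_deriv ?_
    rw [hW t]
    ring
  intro s hs
  have hnn : ∀ x ∈ Set.Ioi s, 0 ≤ ((a x) ^ 2)⁻¹ := fun x _ => by positivity
  have hd1 : ∀ x ∈ Set.Ici s, HasDerivAt (fun t => -(dd t / a t)) (((a x) ^ 2)⁻¹) x :=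
    fun x hx => hderiv x (lt_of_lt_of_le hs hx)
  refine ⟨integrableOn_Ioi_deriv_of_nonneg' hd1 hnn hlim, ?_⟩
  rw [integral_Ioi_of_hasDerivAt_of_nonneg' hd1 hnn hlim]
  have := hapos s hs
  field_simp
  ring
end

section
/- Assume (J) has no conjugate points and that there exists k > 0 with κ(s) > −k² for all s ∈ ℝ. Let f be a solution of (J) with f(0) = 0. Then |f'(s)| ≤ k·coth(ks)·|f(s)| for every s > 0. -/
/-- The bound for a solution that is nonnegative on `[0, ∞)`. -/
theorem jacobi_aux (κ : ℝ → ℝ)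
    (k : ℝ) (hk : 0 < k) (hκk : ∀ s : ℝ, -k ^ 2 < κ s)
    (f f' : ℝ → ℝ) (hf : IsJacobiSol κ f f') (hf0 : f 0 = 0)
    (hpos : ∀ s, 0 ≤ s → 0 ≤ f s) :
    ∀ s : ℝ, 0 < s → |f' s| ≤ k * coth (k * s) * |f s| := by
  intro s hs
  have key : ∀ (c e : ℝ) (a b : ℝ), 0 ≤ a → a ≤ b → 
      (∀ x ∈ Set.Icc a b, 0 ≤ Real.sinh (c + e * x)) → e ^ 2 = k ^ 2 →
      f' b * Real.sinh (c + e * b) - f b * (e * Real.cosh (c + e * b)) ≤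
      f' a * Real.sinh (c + e * a) - f a * (e * Real.cosh (c + e * a)) := by
    intro c e a b ha hab hS he
    have hd : ∀ x, HasDerivAt
        (fun x => f' x * Real.sinh (c + e * x) - f x * (e * Real.cosh (c + e * x)))
        (-(κ x + k ^ 2) * (f x * Real.sinh (c + e * x))) x := by
      intro x
      have hl : HasDerivAt (fun x : ℝ => c + e * x) e x := by
        simpa using ((hasDerivAt_id x).const_mul e).const_add c
      have h := ((hf.2 x).mul hl.sinh).sub ((hf.1 x).mul (hl.cosh.const_mul e))
      refine HasDerivAt.congr_deriv h ?_
      rw [← he]; ring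
    have hanti := antitoneOn_of_deriv_nonpos (convex_Icc a b)
      (fun x _ => (hd x).continuousAt.continuousWithinAt)
      (fun x _ => (hd x).differentiableAt.differentiableWithinAt)
      (fun x hx => by
        rw [interior_Icc] at hx
        have hx' : x ∈ Set.Icc a b := ⟨hx.1.le, hx.2.le⟩
        rw [(hd x).deriv]
        have h1 := hκk x
        have h2 := mul_nonneg (hpos x (ha.trans hx'.1)) (hS x hx')
        nlinarith)
    exact hanti (Set.left_mem_Icc.2 hab) (Set.right_mem_Icc.2 hab) hab
  have hsinh : 0 < Real.sinh (k * s) := Real.sinh_pos_iff.2 (by positivity)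
  have h1 := key 0 k 0 s le_rfl hs.le (fun x hx => by
    rw [Real.sinh_nonneg_iff]
    have := hx.1
    positivity) rfl
  have h2 := key (k * (2 * s)) (-k) s (2 * s) hs.le (by linarith) (fun x hx => by
    rw [Real.sinh_nonneg_iff]
    have := hx.2
    nlinarith) (by ring)
  have e1 : k * (2 * s) + -k * (2 * s) = 0 := by ring
  have e2 : k * (2 * s) + -k * s = k * s := by ring
  rw [e1, e2] at h2
  simp [hf0] at h1 h2
  have h3 := mul_nonneg (hpos (2 * s) (by linarith)) hk.le
  have h4 : k * coth (k * s) * |f s| = k * Real.cosh (k * s) * f s / Real.sinh (k * s) := by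
    rw [abs_of_nonneg (hpos s hs.le), coth]; ring
  rw [h4, le_div_iff₀ hsinh]
  rcases abs_cases (f' s) with ⟨h, _⟩ | ⟨h, _⟩ <;> rw [h] <;> nlinarith

/-- Assume `(J)` has no conjugate points and `κ s > −k²` for all `s`,
where `k > 0`. Let `f` be a solution of `(J)` with `f 0 = 0`. Then
`|f'(s)| ≤ k·coth(ks)·|f(s)|` for every `s > 0`. -/
theorem jacobi_deriv_coth_bound (κ : ℝ → ℝ) (hκ : Continuous κ)
    (hnc : NoConjugatePoints κ)
    (k : ℝ) (hk : 0 < k) (hκk : ∀ s : ℝ, -k ^ 2 < κ s)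
    (f f' : ℝ → ℝ) (hf : IsJacobiSol κ f f') (hf0 : f 0 = 0) :
    ∀ s : ℝ, 0 < s → |f' s| ≤ k * coth (k * s) * |f s| := by
  by_cases hp : ∀ s, 0 ≤ s → 0 ≤ f s
  · exact jacobi_aux κ k hk hκk f f' hf hf0 hp
  by_cases hn : ∀ s, 0 ≤ s → f s ≤ 0
  · have hg : IsJacobiSol κ (fun x => -f x) (fun x => -f' x) := by
      refine ⟨fun s => (hf.1 s).neg, fun s => ?_⟩
      have := (hf.2 s).neg
      exact HasDerivAt.congr_deriv this (by ring)
    have := jacobi_aux κ k hk hκk _ _ hg (by simp [hf0]) (fun s hs => by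
      have := hn s hs
      simpa using this)
    simpa using this
  exfalso
  push Not at hp hn
  obtain ⟨a, ha, hfa⟩ := hp
  obtain ⟨b, hb, hfb⟩ := hn
  have ha' : 0 < a := lt_of_le_of_ne ha (by rintro rfl; linarith)
  have hb' : 0 < b := lt_of_le_of_ne hb (by rintro rfl; linarith)
  have hc : Continuous f := continuous_iff_continuousAt.2 fun x => (hf.1 x).continuousAt
  obtain ⟨c, hcm, hc0⟩ := intermediate_value_uIcc (a := a) (b := b) (f := f) hc.continuousOn
    (Set.mem_uIcc.2 (Or.inl ⟨hfa.le, hfb.le⟩))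
  have h0 := hnc f f' hf ⟨a, hfa.ne⟩ c 0 hc0 hf0
  have := hcm.1
  rw [h0] at this
  exact absurd this (not_le.2 (lt_min ha' hb'))
end

section
/- Assume (J) has no conjugate points and that there exists k > 0 with κ(s) > −k² for all s ∈ ℝ, and set m(s) = ∫_s^∞ a(u)⁻² du for s > 0 (this improper integral converges). Then for every s > 0 with coth(ks) ≤ 2, one has a(s)²·m(s) ≥ 1/(4k); equivalently, a(s) ≥ (4k·m(s))^{−1/2} for such s. -/
open MeasureTheory

/-- positivity of `a` on the positive axis -/
lemma a_pos_aux {κ a a' : ℝ → ℝ} (hnc : NoConjugatePoints κ) (ha : IsJacobiSol κ a a')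
    (ha0 : a 0 = 0) (ha'0 : a' 0 = 1) :
    (∀ t, t ≠ 0 → a t ≠ 0) ∧ ∀ t, 0 < t → 0 < a t := by
  have h0 : HasDerivAt a 1 0 := ha'0 ▸ ha.1 0
  have hcont : Continuous a := continuous_iff_continuousAt.2 fun s => (ha.1 s).continuousAt
  obtain ⟨e, he, hea⟩ : ∃ e, 0 < e ∧ 0 < a e := by
    have hslope := h0.hasDerivWithinAt (s := Set.Ioi 0)
    rw [hasDerivWithinAt_iff_tendsto_slope' (by simp)] at hslope
    have h1 := hslope.eventually (lt_mem_nhds (show (0:ℝ) < 1 by norm_num))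
    obtain ⟨e, h2, h3⟩ := (h1.and self_mem_nhdsWithin).exists
    have h3 : 0 < e := h3
    refine ⟨e, h3, ?_⟩
    simp only [slope_def_field, ha0, sub_zero] at h2
    exact (div_pos_iff_of_pos_right h3).1 h2
  have hne : ∀ t, t ≠ 0 → a t ≠ 0 := fun t ht h => ht (hnc a a' ha ⟨e, hea.ne'⟩ t 0 h ha0)
  refine ⟨hne, fun t ht => ?_⟩
  by_contra hcon
  have hmem : (0:ℝ) ∈ a '' Set.uIcc e t :=
    intermediate_value_uIcc hcont.continuousOn (Set.mem_uIcc.2 (Or.inr ⟨not_lt.1 hcon, hea.le⟩))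
  obtain ⟨x, hx, hx0⟩ := hmem
  have : 0 < x := lt_of_lt_of_le (lt_min he ht) hx.1
  exact hne x this.ne' hx0

/-- A second solution, by the Rofe-Beketov formula. -/
lemma second_sol {κ a a' : ℝ → ℝ} (hκ : Continuous κ) (ha : IsJacobiSol κ a a')
    (ha0 : a 0 = 0) (ha'0 : a' 0 = 1) (hne : ∀ t, t ≠ 0 → a t ≠ 0) :
    ∃ b b' : ℝ → ℝ, IsJacobiSol κ b b' ∧ b 0 = -1 ∧ ∀ t, a t * b' t - a' t * b t = 1 := by
  have hca : Continuous a := continuous_iff_continuousAt.2 fun s => (ha.1 s).continuousAt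
  have hca' : Continuous a' := continuous_iff_continuousAt.2 fun s => (ha.2 s).continuousAt
  set N : ℝ → ℝ := fun t => a t ^ 2 + a' t ^ 2 with hN
  have hNpos : ∀ t, 0 < a t ^ 2 + a' t ^ 2 := by
    intro t
    by_cases ht : t = 0
    · subst ht; rw [ha0, ha'0]; norm_num
    · have := hne t ht
      positivity
  have hNne : ∀ t, a t ^ 2 + a' t ^ 2 ≠ 0 := fun t => (hNpos t).ne'
  set q : ℝ → ℝ := fun t => (1 - κ t) * (a t ^ 2 - a' t ^ 2) / (a t ^ 2 + a' t ^ 2) ^ 2 with hq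
  have hqc : Continuous q := by
    apply Continuous.div (by fun_prop) (by fun_prop)
    intro t; exact pow_ne_zero 2 (hNne t)
  set F : ℝ → ℝ := fun t => ∫ x in (0:ℝ)..t, q x with hF
  have hFd : ∀ t, HasDerivAt F (q t) t := fun t => hqc.integral_hasStrictDerivAt 0 t |>.hasDerivAt
  have hNd : ∀ t, HasDerivAt N (2 * a t * a' t * (1 - κ t)) t := by
    intro t
    have := ((ha.1 t).pow 2).add ((ha.2 t).pow 2)
    refine this.congr_deriv ?_
    simp; ring
  refine ⟨fun t => a t * F t - a' t / N t, fun t => a' t * F t + a t / N t, ⟨?_, ?_⟩, ?_, ?_⟩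
  · intro t
    refine (((ha.1 t).mul (hFd t)).sub ((ha.2 t).div (hNd t) (hNne t))).congr_deriv ?_
    have := hNne t
    simp only [hq, hN]
    field_simp
    ring
  · intro t
    refine (((ha.2 t).mul (hFd t)).add ((ha.1 t).div (hNd t) (hNne t))).congr_deriv ?_
    have := hNne t
    simp only [hq, hN]
    field_simp
    ring
  · simp [hN, ha0, ha'0]
  · intro t
    have := hNne t
    simp only [hN]
    field_simp
    ring

/-- integrability of `a⁻²` at infinity -/
lemma integrable_aux {κ a a' : ℝ → ℝ} (hκ : Continuous κ) (hnc : NoConjugatePoints κ)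
    (ha : IsJacobiSol κ a a') (ha0 : a 0 = 0) (ha'0 : a' 0 = 1) (s : ℝ) (hs : 0 < s) :
    IntegrableOn (fun u => ((a u) ^ 2)⁻¹) (Set.Ioi s) := by
  obtain ⟨hne, hpos⟩ := a_pos_aux hnc ha ha0 ha'0
  obtain ⟨b, b', hb, hb0, hW⟩ := second_sol hκ ha ha0 ha'0 hne
  have hca : Continuous a := continuous_iff_continuousAt.2 fun s => (ha.1 s).continuousAt
  have hcb : Continuous b := continuous_iff_continuousAt.2 fun s => (hb.1 s).continuousAt
  set c := b (-1) / a (-1) with hc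
  have ham : a (-1) ≠ 0 := hne _ (by norm_num)
  have hsol : IsJacobiSol κ (fun t => b t - c * a t) (fun t => b' t - c * a' t) := by
    refine ⟨fun t => (hb.1 t).sub ((ha.1 t).const_mul c), fun t => ?_⟩
    refine ((hb.2 t).sub ((ha.2 t).const_mul c)).congr_deriv ?_
    ring
  have hlt : ∀ t, 0 < t → b t < c * a t := by
    intro t ht
    by_contra hcon
    have hmem : (0:ℝ) ∈ (fun t => b t - c * a t) '' Set.Icc 0 t :=
      intermediate_value_Icc ht.le (by fun_prop)
        ⟨by simp [hb0, ha0], by simp only [sub_nonneg]; exact not_lt.1 hcon⟩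
    obtain ⟨x, hx, hx0⟩ := hmem
    have := hnc _ _ hsol ⟨0, by simp [hb0, ha0]⟩ x (-1) hx0 (by simp [hc, ham])
    linarith [hx.1]
  have hcontOn : ∀ T, s ≤ T → ContinuousOn (fun u => ((a u) ^ 2)⁻¹) (Set.Icc s T) := by
    intro T _
    apply ContinuousOn.inv₀ (by fun_prop)
    intro x hx
    exact pow_ne_zero 2 (hpos x (lt_of_lt_of_le hs hx.1)).ne'
  refine integrableOn_Ioi_of_intervalIntegral_norm_bounded (c - b s / a s) s
    (l := Filter.atTop) (b := fun T : ℝ => max s T) ?_ ?_ ?_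
  · intro T
    exact ((hcontOn _ (le_max_left _ _)).integrableOn_Icc).mono_set Set.Ioc_subset_Icc_self
  · exact Filter.tendsto_atTop_mono (fun T => le_max_right s T) Filter.tendsto_id
  · refine Filter.Eventually.of_forall fun T => ?_
    have hsT : s ≤ max s T := le_max_left _ _
    have hTp : 0 < max s T := lt_of_lt_of_le hs hsT
    have h1 : ∀ x ∈ Set.uIcc s (max s T), HasDerivAt (fun u => b u / a u) (((a x) ^ 2)⁻¹) x := by
      intro x hx
      rw [Set.uIcc_of_le hsT] at hx
      have hax := (hpos x (lt_of_lt_of_le hs hx.1)).ne'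
      refine ((hb.1 x).div (ha.1 x) hax).congr_deriv ?_
      rw [inv_eq_one_div, ← hW x]; ring
    have h2 := intervalIntegral.integral_eq_sub_of_hasDerivAt h1
      ((hcontOn _ hsT).intervalIntegrable_of_Icc hsT)
    have h3 : ∫ x in s..(max s T), ‖((a x) ^ 2)⁻¹‖ = ∫ x in s..(max s T), ((a x) ^ 2)⁻¹ := by
      congr 1; ext x; rw [Real.norm_of_nonneg (by positivity)]
    rw [h3, h2]
    have : b (max s T) / a (max s T) ≤ c := by
      rw [div_le_iff₀ (hpos _ hTp)]; exact (hlt _ hTp).le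
    linarith

/-- `a' ≤ 2 k a` beyond `s` -/
lemma deriv_bound {κ a a' : ℝ → ℝ} (hpos : ∀ t, 0 < t → 0 < a t)
    (ha : IsJacobiSol κ a a') (ha0 : a 0 = 0)
    (k : ℝ) (hk : 0 < k) (hκk : ∀ s : ℝ, -k ^ 2 < κ s) (s : ℝ) (hs : 0 < s)
    (hcoth : coth (k * s) ≤ 2) (u : ℝ) (hu : s ≤ u) : a' u ≤ 2 * k * a u := by
  have hu0 : 0 < u := hs.trans_le hu
  have hd : ∀ t, HasDerivAt (fun t => a' t * Real.sinh (k * t) - k * a t * Real.cosh (k * t))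
      (-(κ t + k ^ 2) * a t * Real.sinh (k * t)) t := by
    intro t
    have hl : HasDerivAt (fun t => k * t) k t := by simpa using (hasDerivAt_id t).const_mul k
    refine (((ha.2 t).mul hl.sinh).sub (((ha.1 t).const_mul k).mul hl.cosh)).congr_deriv ?_
    ring
  have hanti : AntitoneOn (fun t => a' t * Real.sinh (k * t) - k * a t * Real.cosh (k * t))
      (Set.Ici 0) := by
    refine antitoneOn_of_deriv_nonpos (convex_Ici 0)
      (fun t _ => (hd t).continuousAt.continuousWithinAt)
      (fun t _ => (hd t).differentiableAt.differentiableWithinAt) ?_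
    intro t ht
    rw [interior_Ici] at ht
    have ht : 0 < t := ht
    rw [(hd t).deriv]
    have h1 : 0 < Real.sinh (k * t) := Real.sinh_pos_iff.2 (by positivity)
    have h2 := hpos t ht
    have h3 : 0 < κ t + k ^ 2 := by linarith [hκk t]
    have := mul_pos (mul_pos h3 h2) h1
    linarith
  have hg := hanti (Set.mem_Ici.2 le_rfl) (Set.mem_Ici.2 hu0.le) hu0.le
  simp only [ha0, mul_zero, Real.sinh_zero, zero_mul, sub_zero] at hg
  have hsu : 0 < Real.sinh (k * u) := Real.sinh_pos_iff.2 (by positivity)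
  have hss : 0 < Real.sinh (k * s) := Real.sinh_pos_iff.2 (by positivity)
  have hc1 : Real.cosh (k * s) ≤ 2 * Real.sinh (k * s) := by
    rw [coth, div_le_iff₀ hss] at hcoth; exact hcoth
  have hc2 : Real.cosh (k * u) ≤ 2 * Real.sinh (k * u) := by
    rw [Real.cosh_eq, Real.sinh_eq] at *
    have h1 : Real.exp (k * s) ≤ Real.exp (k * u) := Real.exp_le_exp.2 (by nlinarith)
    have h2 : Real.exp (-(k * u)) ≤ Real.exp (-(k * s)) := Real.exp_le_exp.2 (by nlinarith)
    linarith
  have h3 : k * a u * Real.cosh (k * u) ≤ k * a u * (2 * Real.sinh (k * u)) :=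
    mul_le_mul_of_nonneg_left hc2 (by have := hpos u hu0; positivity)
  refine le_of_mul_le_mul_right ?_ hsu
  linarith

lemma growth_bound {κ a a' : ℝ → ℝ}
    (ha : IsJacobiSol κ a a') (k : ℝ) (s : ℝ)
    (h : ∀ u, s ≤ u → a' u ≤ 2 * k * a u) (u : ℝ) (hu : s ≤ u) :
    a u ≤ a s * Real.exp (2 * k * (u - s)) := by
  have hd : ∀ t, HasDerivAt (fun t => a t * Real.exp (-(2 * k * (t - s))))
      ((a' t - 2 * k * a t) * Real.exp (-(2 * k * (t - s)))) t := by
    intro t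
    have hl : HasDerivAt (fun t => -(2 * k * (t - s))) (-(2 * k)) t := by
      refine ((((hasDerivAt_id t).sub_const s).const_mul (2 * k)).neg).congr_deriv ?_
      ring
    refine ((ha.1 t).mul hl.exp).congr_deriv ?_
    ring
  have hanti : AntitoneOn (fun t => a t * Real.exp (-(2 * k * (t - s)))) (Set.Ici s) := by
    refine antitoneOn_of_deriv_nonpos (convex_Ici s)
      (fun t _ => (hd t).continuousAt.continuousWithinAt)
      (fun t _ => (hd t).differentiableAt.differentiableWithinAt) ?_
    intro t ht
    rw [interior_Ici] at ht
    rw [(hd t).deriv]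
    exact mul_nonpos_of_nonpos_of_nonneg (by linarith [h t (le_of_lt ht)]) (Real.exp_pos _).le
  have hg := hanti (Set.mem_Ici.2 le_rfl) (Set.mem_Ici.2 hu) hu
  simp only [sub_self, mul_zero, neg_zero, Real.exp_zero, mul_one] at hg
  rw [Real.exp_neg, ← div_eq_mul_inv, div_le_iff₀ (Real.exp_pos _)] at hg
  exact hg

/-- Assume `(J)` has no conjugate points and `κ s > −k²` for all `s`,
where `k > 0`; set `m s = ∫_s^∞ a(u)⁻² du` for `s > 0` (this improper integral
converges). Then for every `s > 0` with `coth (k s) ≤ 2`, one has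
`a(s)²·m(s) ≥ 1/(4k)`; equivalently, `a(s) ≥ (4k·m(s))^{−1/2}` for such `s`. -/
theorem a_lower_bound (κ : ℝ → ℝ) (hκ : Continuous κ)
    (hnc : NoConjugatePoints κ)
    (k : ℝ) (hk : 0 < k) (hκk : ∀ s : ℝ, -k ^ 2 < κ s)
    (a a' : ℝ → ℝ) (ha : IsJacobiSol κ a a') (ha0 : a 0 = 0) (ha'0 : a' 0 = 1)
    (m : ℝ → ℝ) (hm : ∀ s : ℝ, 0 < s → m s = ∫ u in Set.Ioi s, ((a u) ^ 2)⁻¹) :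
    ∀ s : ℝ, 0 < s →
      IntegrableOn (fun u => ((a u) ^ 2)⁻¹) (Set.Ioi s) ∧
      (coth (k * s) ≤ 2 →
        1 / (4 * k) ≤ (a s) ^ 2 * m s ∧ (Real.sqrt (4 * k * m s))⁻¹ ≤ a s) := by
  intro s hs
  have hint := integrable_aux hκ hnc ha ha0 ha'0 s hs
  refine ⟨hint, fun hcoth => ?_⟩
  have hpos := (a_pos_aux hnc ha ha0 ha'0).2
  have has := hpos s hs
  have hgr := growth_bound ha k s (deriv_bound hpos ha ha0 k hk hκk s hs hcoth)
  have hneg : -(4 * k) < 0 := by linarith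
  have hexp : IntegrableOn (fun u => ((a s) ^ 2)⁻¹ * Real.exp (4 * k * s) *
      Real.exp (-(4 * k) * u)) (Set.Ioi s) :=
    (integrableOn_exp_mul_Ioi hneg s).const_mul _
  have hle : ∫ u in Set.Ioi s, ((a s) ^ 2)⁻¹ * Real.exp (4 * k * s) * Real.exp (-(4 * k) * u)
      ≤ ∫ u in Set.Ioi s, ((a u) ^ 2)⁻¹ := by
    refine setIntegral_mono_on hexp hint measurableSet_Ioi fun u hu => ?_
    have hu : s < u := hu
    have hau := hpos u (hs.trans hu)
    have h1 : (a u) ^ 2 ≤ (a s * Real.exp (2 * k * (u - s))) ^ 2 :=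
      pow_le_pow_left₀ hau.le (hgr u hu.le) 2
    have h2 := inv_anti₀ (by positivity) h1
    refine le_trans (le_of_eq ?_) h2
    rw [mul_pow, mul_inv, ← Real.exp_nat_mul, ← Real.exp_neg, mul_assoc, ← Real.exp_add]
    congr 2
    push_cast; ring
  rw [integral_const_mul, integral_exp_mul_Ioi hneg, ← hm s hs] at hle
  have hval : ((a s) ^ 2)⁻¹ * Real.exp (4 * k * s) * (-Real.exp (-(4 * k) * s) / -(4 * k))
      = ((a s) ^ 2)⁻¹ * (1 / (4 * k)) := by
    rw [neg_mul, Real.exp_neg]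
    have := Real.exp_pos (4 * k * s)
    field_simp
  rw [hval] at hle
  have h1 : 1 / (4 * k) ≤ (a s) ^ 2 * m s := by
    rwa [inv_mul_le_iff₀ (by positivity)] at hle
  refine ⟨h1, ?_⟩
  have h2 : (a s)⁻¹ ≤ Real.sqrt (4 * k * m s) := by
    apply Real.le_sqrt_of_sq_le
    rw [inv_pow]
    have := mul_le_mul_of_nonneg_left hle (show 0 ≤ 4 * k by positivity)
    refine le_trans (le_of_eq ?_) this
    field_simp
  exact inv_le_of_inv_le₀ has h2
end
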